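/- Let V be a finite vertex set with capacities c, let U and W be disjoint subsets of V, and let b : U → ℝ with b(u) ≥ 0 for all u ∈ U. Consider functions g : V × V → ℝ with 0 ≤ g(u,v) ≤ c(u,v) for all u,v, ex(g,v) = 0 for every v ∉ U ∪ W, 0 ≤ −ex(g,u) ≤ b(u) for every u ∈ U, and ex(g,w) ≥ 0 for every w ∈ W; call such g admissible, with value |g| = Σ_{u∈U} (−ex(g,u)). Suppose g is admissible and maximizes |g| among all admissible functions. Then for every u ∈ U, either −ex(g,u) = b(u), or there is no residual path with respect to g from u to any vertex of W. -/

import Mathlib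

open Finset

/-- The excess of a vertex `v` under `g`: total flow into `v` minus total flow out of `v`. -/
def ex {V : Type*} [Fintype V] (g : V → V → ℝ) (v : V) : ℝ :=
  (∑ u, g u v) - (∑ u, g v u)

/-- Residual capacity of the arc `(u,v)` with respect to capacities `c` and flow `g`. -/
def cRes {V : Type*} (c g : V → V → ℝ) (u v : V) : ℝ :=
  c u v - g u v + g v u

/-- A residual path from `a` to `b` with respect to `g`. -/
def ResPath {V : Type*} (c g : V → V → ℝ) (a b : V) : Prop :=
  ∃ (m : ℕ) (p : ℕ → V), p 0 = a ∧ p m = b ∧ ∀ i < m, 0 < cRes c g (p i) (p (i + 1))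

/-- An admissible function: a flow from `U` to `W` where each source `u ∈ U` sends
at most `b u` units of flow. -/
def Admissible {V : Type*} [Fintype V] [DecidableEq V] (c : V → V → ℝ)
    (U W : Finset V) (b : V → ℝ) (g : V → V → ℝ) : Prop :=
  (∀ u v, 0 ≤ g u v ∧ g u v ≤ c u v) ∧
  (∀ v, v ∉ U ∪ W → ex g v = 0) ∧
  (∀ u ∈ U, 0 ≤ -ex g u ∧ -ex g u ≤ b u) ∧
  (∀ w ∈ W, 0 ≤ ex g w)

def FeasDir {V : Type*} (c g d : V → V → ℝ) : Prop :=
  ∃ e0 : ℝ, 0 < e0 ∧ ∀ e : ℝ, 0 ≤ e → e ≤ e0 → ∀ x y, 0 ≤ g x y + e * d x y ∧ g x y + e * d x y ≤ c x y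

lemma FeasDir.sum {V : Type*} {c g d₁ d₂ : V → V → ℝ} (h₁ : FeasDir c g d₁)
    (h₂ : FeasDir c g d₂) : FeasDir c g (fun x y => d₁ x y + d₂ x y) := by
  obtain ⟨e₁, p₁, h₁⟩ := h₁
  obtain ⟨e₂, p₂, h₂⟩ := h₂
  refine ⟨min e₁ e₂ / 2, by positivity, fun e he0 he x y => ?_⟩
  have a₁ := h₁ (2 * e) (by linarith) (by linarith [min_le_left e₁ e₂]) x y
  have a₂ := h₂ (2 * e) (by linarith) (by linarith [min_le_right e₁ e₂]) x y
  constructor <;> nlinarith [a₁.1, a₁.2, a₂.1, a₂.2]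

lemma ex_comb {V : Type*} [Fintype V] (g d : V → V → ℝ) (e : ℝ) (v : V) :
    ex (fun x y => g x y + e * d x y) v = ex g v + e * ex d v := by
  simp only [ex, Finset.sum_add_distrib, ← Finset.mul_sum]
  ring

lemma ex_single {V : Type*} [Fintype V] [DecidableEq V] (a b : V) (t : ℝ) (v : V) :
    ex (fun x y => if x = a then (if y = b then t else 0) else 0) v
      = t * ((if v = b then 1 else 0) - (if v = a then 1 else 0)) := by
  simp only [ex, Finset.sum_ite_eq', Finset.mem_univ, if_true]
  by_cases h1 : v = a <;> by_cases h2 : v = b <;>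
    simp [h1, h2] <;> split_ifs <;> ring

lemma exists_edge {V : Type*} [Fintype V] [DecidableEq V] {c g : V → V → ℝ}
    (hg : ∀ u v, 0 ≤ g u v ∧ g u v ≤ c u v) (a b : V) (h : 0 < cRes c g a b) :
    ∃ d, FeasDir c g d ∧ ∀ v, ex d v = (if v = b then 1 else 0) - (if v = a then 1 else 0) := by
  by_cases hcg : g a b < c a b
  · refine ⟨fun x y => if x = a then (if y = b then 1 else 0) else 0,
      ⟨c a b - g a b, by linarith, fun e he0 he x y => ?_⟩, fun v => ?_⟩
    · have := hg x y
      by_cases h1 : x = a <;> by_cases h2 : y = b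
      · subst h1 h2
        simp only [if_true]
        constructor <;> linarith
      all_goals simp [h1, h2, hg]
    · rw [ex_single]; ring
  · have hp : 0 < g b a := by
      unfold cRes at h
      linarith
    refine ⟨fun x y => if x = b then (if y = a then -1 else 0) else 0,
      ⟨g b a, hp, fun e he0 he x y => ?_⟩, fun v => ?_⟩
    · have := hg x y
      by_cases h1 : x = b <;> by_cases h2 : y = a
      · subst h1 h2
        simp only [if_true]
        constructor <;> linarith
      all_goals simp [h1, h2, hg]
    · rw [ex_single]; ring

lemma exists_path {V : Type*} [Fintype V] [DecidableEq V] {c g : V → V → ℝ}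
    (hg : ∀ u v, 0 ≤ g u v ∧ g u v ≤ c u v) (p : ℕ → V) (m : ℕ)
    (h : ∀ i < m, 0 < cRes c g (p i) (p (i + 1))) :
    ∃ d, FeasDir c g d ∧
      ∀ v, ex d v = (if v = p m then 1 else 0) - (if v = p 0 then 1 else 0) := by
  induction m with
  | zero =>
    refine ⟨fun _ _ => 0, ⟨1, one_pos, fun e _ _ x y => by simpa using hg x y⟩, fun v => ?_⟩
    simp [ex]
  | succ m ih =>
    obtain ⟨d₁, f₁, x₁⟩ := ih fun i hi => h i (by omega)
    obtain ⟨d₂, f₂, x₂⟩ := exists_edge hg _ _ (h m (by omega))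
    refine ⟨_, f₁.sum f₂, fun v => ?_⟩
    have := ex_comb d₁ d₂ 1 v
    simp only [one_mul] at this
    rw [this, x₁, x₂]
    ring

/-- Property (5*) of the `Bulk-Push` implementation: after a maximum flow from `U` to `W`
limited by the excesses `b`, every source `u ∈ U` either exhausts its limit `b u` or has
no residual path to any sink in `W`. -/
theorem stmt12 {V : Type*} [Fintype V] [DecidableEq V] (c : V → V → ℝ)
    (U W : Finset V) (hUW : Disjoint U W)
    (hc : ∀ u v, 0 ≤ c u v)
    (b : V → ℝ) (hb : ∀ u ∈ U, 0 ≤ b u)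
    (g : V → V → ℝ)
    (hadm : Admissible c U W b g)
    (hmax : ∀ g' : V → V → ℝ, Admissible c U W b g' →
      (∑ u ∈ U, -ex g' u) ≤ ∑ u ∈ U, -ex g u) :
    ∀ u ∈ U, -ex g u = b u ∨ ∀ w ∈ W, ¬ ResPath c g u w := by
  intro u hu
  by_contra hcon
  push Not at hcon
  obtain ⟨hne, w, hw, m, p, h0, hm, hp⟩ := hcon
  obtain ⟨hg, hz, hU, hW⟩ := hadm
  obtain ⟨d, ⟨e0, he0, hd⟩, hx⟩ := exists_path hg p m hp
  rw [h0, hm] at hx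
  have hlt : 0 < b u + ex g u := by
    have := lt_of_le_of_ne (hU u hu).2 hne
    linarith
  obtain ⟨e, hepos, hle0, hleb⟩ : ∃ e : ℝ, 0 < e ∧ e ≤ e0 ∧ e ≤ b u + ex g u :=
    ⟨min e0 (b u + ex g u), lt_min he0 hlt, min_le_left _ _, min_le_right _ _⟩
  have hnW : ∀ v ∈ U, v ≠ w := fun v hv h => Finset.disjoint_left.mp hUW hv (h ▸ hw)
  have hxU : ∀ v ∈ U, ex (fun x y => g x y + e * d x y) v
      = ex g v - (if v = u then e else 0) := by
    intro v hv
    rw [ex_comb, hx, if_neg (hnW v hv)]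
    split_ifs <;> ring
  have hle := hmax (fun x y => g x y + e * d x y) ⟨hd e hepos.le hle0, ?_, ?_, ?_⟩
  · have hs : (∑ v ∈ U, -ex (fun x y => g x y + e * d x y) v) = (∑ v ∈ U, -ex g v) + e := by
      rw [Finset.sum_congr rfl fun v hv => by rw [hxU v hv, neg_sub, sub_eq_neg_add],
        Finset.sum_add_distrib]
      simp [hu]
    linarith
  · intro v hv
    have h1 : v ≠ w := fun h => hv (by simp [h, hw])
    have h2 : v ≠ u := fun h => hv (by simp [h, hu])
    rw [ex_comb, hx, hz v hv]
    simp [h1, h2]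
  · intro v hv
    rw [hxU v hv]
    have := hU v hv
    split_ifs with h
    · subst h
      constructor <;> linarith
    · simpa using this
  · intro v hv
    have h2 : v ≠ u := fun h => hnW u hu |> fun _ => Finset.disjoint_left.mp hUW hu (h ▸ hv)
    have := hW v hv
    rw [ex_comb, hx, if_neg h2]
    split_ifs
    · linarith
    · simpa using this
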